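/- The Cartan cubic in dimension 5, f₁(x) = x₅³ − 3x₅x₄² + (3/2)x₅(x₁² + x₂² − 2x₃²) + (3√3/2)x₄(x₁² − x₂²) + 3√3·x₁x₂x₃, satisfies both the eiconal equation |∇f₁(x)|² = 9|x|⁴ for all x ∈ ℝ⁵ and the Laplace equation Δf₁ = 0. -/

import Mathlib

open MvPolynomial

/-- The Cartan isoparametric cubic in dimension 5 (corresponding to `ℝ`, `d = 1`),
with `xᵢ = X (i−1)`:
`f₁ = x₅³ − 3x₅x₄² + (3/2)x₅(x₁² + x₂² − 2x₃²) + (3√3/2)x₄(x₁² − x₂²) + 3√3·x₁x₂x₃`. -/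
noncomputable def cartanCubic5 : MvPolynomial (Fin 5) ℝ :=
  X 4 ^ 3 - 3 * X 4 * X 3 ^ 2 +
    C ((3 : ℝ) / 2) * X 4 * (X 0 ^ 2 + X 1 ^ 2 - 2 * X 2 ^ 2) +
    C (3 * Real.sqrt 3 / 2) * X 3 * (X 0 ^ 2 - X 1 ^ 2) +
    C (3 * Real.sqrt 3) * X 0 * X 1 * X 2

/-- The Cartan cubic in dimension 5 satisfies both the eiconal equation
`|∇f₁|² = 9|x|⁴` and the Laplace equation `Δf₁ = 0`. -/
theorem cartanCubic5_isoparametric :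
    (∀ x : Fin 5 → ℝ,
      ∑ i, (eval x (pderiv i cartanCubic5)) ^ 2 = 9 * (∑ i, x i ^ 2) ^ 2) ∧
    (∑ i, pderiv i (pderiv i cartanCubic5) = 0) := by
  have h2 : (2 : MvPolynomial (Fin 5) ℝ) = C 2 := (map_ofNat C 2).symm
  have h3 : (3 : MvPolynomial (Fin 5) ℝ) = C 3 := (map_ofNat C 3).symm
  have hs : Real.sqrt 3 ^ 2 = 3 := Real.sq_sqrt (by norm_num)
  refine ⟨fun x => ?_, MvPolynomial.funext fun x => ?_⟩
  · simp [cartanCubic5, h2, h3, Fin.sum_univ_five, pderiv_X, Derivation.leibniz,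
      Derivation.leibniz_pow, Pi.single_apply]
    linear_combination (9 / 4 * (x 0 ^ 2 - x 1 ^ 2) ^ 2 +
      9 * (x 3 * x 0 + x 1 * x 2) ^ 2 + 9 * (x 0 * x 2 - x 3 * x 1) ^ 2 +
      9 * (x 0 * x 1) ^ 2) * hs
  · simp [cartanCubic5, h2, h3, Fin.sum_univ_five, pderiv_X, Derivation.leibniz,
      Derivation.leibniz_pow, Pi.single_apply]
    ring
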